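/- Under the standing assumptions, let q be a prime divisor of m and let k be a positive integer such that q^k does not divide x₁^(q−1) − y₁^(q−1). Then there are at most k distinct odd primes p with p ∤ x₁·y₁, ℓ_p ∣ m and q ∣ ℓ_p. -/

import Mathlib

/-- `ellp a b p` is the least positive integer `ℓ` such that `p ∣ a ^ ℓ - b ^ ℓ`
(and `0` if no such integer exists). -/
noncomputable def ellp (a b p : ℕ) : ℕ := sInf {ℓ : ℕ | 0 < ℓ ∧ p ∣ a ^ ℓ - b ^ ℓ}

lemma exists_unit_ratio (a b M : ℕ) (hab : b ≤ a) (ha : a.Coprime M) (hb : b.Coprime M) :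
    ∃ u : (ZMod M)ˣ, ∀ j : ℕ, M ∣ a ^ j - b ^ j ↔ u ^ j = 1 := by
  refine ⟨ZMod.unitOfCoprime a ha * (ZMod.unitOfCoprime b hb)⁻¹, fun j => ?_⟩
  rw [mul_pow, inv_pow, mul_inv_eq_one, Units.ext_iff]
  simp only [Units.val_pow_eq_pow_val, ZMod.coe_unitOfCoprime]
  rw [← ZMod.natCast_eq_zero_iff, Nat.cast_sub (Nat.pow_le_pow_left hab j), sub_eq_zero]
  push_cast
  rfl

lemma ellp_dvd_facts (a b p q m : ℕ) (hab : b ≤ a) (hp : p.Prime) (hpab : ¬ p ∣ a * b)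
    (hq : q.Prime) (hlm : ellp a b p ∣ m) (hql : q ∣ ellp a b p) :
    q ∣ p - 1 ∧ p ∣ a ^ m - b ^ m ∧ ¬ p ∣ a - b := by
  have ha : a.Coprime p := ((hp.coprime_iff_not_dvd).2 fun h => hpab (h.mul_right b)).symm
  have hb : b.Coprime p := ((hp.coprime_iff_not_dvd).2 fun h => hpab (h.mul_left a)).symm
  obtain ⟨u, hu⟩ := exists_unit_ratio a b p hab ha hb
  have : Fact p.Prime := ⟨hp⟩
  have hl : ellp a b p = orderOf u := by
    unfold ellp
    apply le_antisymm
    · exact Nat.sInf_le ⟨orderOf_pos u, (hu _).2 (pow_orderOf_eq_one u)⟩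
    · have hne : {ℓ : ℕ | 0 < ℓ ∧ p ∣ a ^ ℓ - b ^ ℓ}.Nonempty :=
        ⟨_, orderOf_pos u, (hu _).2 (pow_orderOf_eq_one u)⟩
      have h := Nat.sInf_mem hne
      exact orderOf_le_of_pow_eq_one h.1 ((hu _).1 h.2)
  rw [hl] at hlm hql
  refine ⟨?_, ?_, ?_⟩
  · refine hql.trans (orderOf_dvd_of_pow_eq_one ?_)
    exact ZMod.units_pow_card_sub_one_eq_one p u
  · exact (hu m).2 (orderOf_dvd_iff_pow_eq_one.1 hlm)
  · intro h
    have h1 : u ^ 1 = 1 := (hu 1).1 (by simpa using h)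
    have h2 : q ∣ 1 := hql.trans (orderOf_dvd_of_pow_eq_one h1)
    exact hq.one_lt.ne' (Nat.dvd_one.1 h2)

lemma pow_dvd_sub_of (a b q n k : ℕ) (hab : b ≤ a) (hcop : a.Coprime b) (hq : q.Prime)
    (hn : 0 < n) (hk : 0 < k) (hqn : ¬ q ∣ n) (h : q ^ k ∣ a ^ n - b ^ n) :
    q ^ k ∣ a ^ (q - 1) - b ^ (q - 1) := by
  have hq1 : q ∣ a ^ n - b ^ n := (dvd_pow_self q hk.ne').trans h
  have hle := Nat.pow_le_pow_left hab n
  have hadd : a ^ n = (a ^ n - b ^ n) + b ^ n := by omega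
  have hiff : q ∣ a ^ n ↔ q ∣ b ^ n := by
    rw [hadd]; exact (Nat.dvd_add_right hq1)
  have hno : ¬ (q ∣ a ∧ q ∣ b) := fun ⟨h1, h2⟩ =>
    hq.one_lt.ne' (Nat.dvd_one.1 (hcop ▸ Nat.dvd_gcd h1 h2))
  have hqa : ¬ q ∣ a := fun h1 =>
    hno ⟨h1, hq.dvd_of_dvd_pow (hiff.1 (h1.trans (dvd_pow_self a hn.ne')))⟩
  have hqb : ¬ q ∣ b := fun h1 =>
    hno ⟨hq.dvd_of_dvd_pow (hiff.2 (h1.trans (dvd_pow_self b hn.ne'))), h1⟩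
  obtain ⟨u, hu⟩ := exists_unit_ratio a b (q ^ k) hab
    (((hq.coprime_iff_not_dvd).2 hqa).symm.pow_right k)
    (((hq.coprime_iff_not_dvd).2 hqb).symm.pow_right k)
  rw [hu] at h ⊢
  rw [← orderOf_dvd_iff_pow_eq_one] at h ⊢
  have h2 : orderOf u ∣ q ^ (k - 1) * (q - 1) := by
    rw [← Nat.totient_prime_pow hq hk]
    exact orderOf_dvd_of_pow_eq_one (ZMod.pow_totient u)
  refine Nat.Coprime.dvd_of_dvd_mul_left ?_ h2
  exact Nat.Coprime.coprime_dvd_left h (((hq.coprime_iff_not_dvd).2 hqn).symm.pow_right _)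

lemma totient_val (N q : ℕ) (hN : N ≠ 0) (hq : q.Prime) (S : Finset ℕ)
    (hS : ∀ p ∈ S, p.Prime ∧ p ∣ N ∧ q ∣ p - 1) :
    S.card + N.factorization q ≤ (Nat.totient N).factorization q + 1 := by
  have key := Nat.totient_mul_prod_primeFactors N
  have hP0 : ∏ p ∈ N.primeFactors, p ≠ 0 :=
    Finset.prod_ne_zero_iff.2 fun p hp => (Nat.prime_of_mem_primeFactors hp).ne_zero
  have hQ0 : ∏ p ∈ N.primeFactors, (p - 1) ≠ 0 :=
    Finset.prod_ne_zero_iff.2 fun p hp => by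
      have := (Nat.prime_of_mem_primeFactors hp).one_lt; omega
  have ht0 : Nat.totient N ≠ 0 := (Nat.totient_pos.2 (Nat.pos_of_ne_zero hN)).ne'
  have e := congrArg (fun t => t.factorization q) key
  simp only [Nat.factorization_mul ht0 hP0, Nat.factorization_mul hN hQ0, Finsupp.add_apply] at e
  have h1 : (∏ p ∈ N.primeFactors, p).factorization q ≤ 1 := by
    rw [Nat.factorization_prod_apply fun p hp => (Nat.prime_of_mem_primeFactors hp).ne_zero]
    calc _ = ∑ p ∈ N.primeFactors, (if p = q then 1 else 0) :=
          Finset.sum_congr rfl fun p hp => by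
            rw [(Nat.prime_of_mem_primeFactors hp).factorization, Finsupp.single_apply]
      _ ≤ 1 := by
          rw [Finset.sum_ite_eq']; split_ifs <;> simp
  have h2 : S.card ≤ (∏ p ∈ N.primeFactors, (p - 1)).factorization q := by
    rw [← hq.pow_dvd_iff_le_factorization hQ0]
    have hsub : S ⊆ N.primeFactors := fun p hp =>
      Nat.mem_primeFactors.2 ⟨(hS p hp).1, (hS p hp).2.1, hN⟩
    refine dvd_trans ?_ (Finset.prod_dvd_prod_of_subset _ _ _ hsub)
    rw [← Finset.prod_const]
    exact Finset.prod_dvd_prod_of_dvd _ _ fun p hp => (hS p hp).2.2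
  omega

lemma quot_form (d a b n : ℕ) (hd : 0 < d) (hab : b < a) (hn : 0 < n) :
    ∃ B, a ^ n - b ^ n = (a - b) * B ∧
      ((d * a) ^ n - (d * b) ^ n) / (d * a - d * b) = d ^ (n - 1) * B := by
  obtain ⟨B, hB⟩ := Nat.sub_dvd_pow_sub_pow a b n
  refine ⟨B, hB, ?_⟩
  have hc : 0 < a - b := by omega
  rw [← Nat.mul_sub, mul_pow, mul_pow, ← Nat.mul_sub, hB]
  apply Nat.div_eq_of_eq_mul_right (Nat.mul_pos hd hc)
  obtain ⟨r, rfl⟩ : ∃ r, n = r + 1 := ⟨n - 1, by omega⟩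
  simp only [Nat.add_sub_cancel]
  ring

theorem at_most_k_primes (x y z m n : ℕ) (hx : 0 < x) (hy : 0 < y) (hz : 0 < z)
    (hm : 0 < m) (hn : 0 < n) (hxy : y < x) (hzxy : z ≤ x - y)
    (hgcd : Nat.gcd m n = 1) (hmn : n < m)
    (heq : Nat.totient (z * ((x ^ m - y ^ m) / (x - y))) =
      z * ((x ^ n - y ^ n) / (x - y)))
    (d₁ x₁ y₁ : ℕ) (hd₁ : d₁ = Nat.gcd x y) (hx₁ : x₁ = x / d₁) (hy₁ : y₁ = y / d₁)
    (q : ℕ) (hq : q.Prime) (hqm : q ∣ m)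
    (k : ℕ) (hk : 0 < k) (hqk : ¬ q ^ k ∣ x₁ ^ (q - 1) - y₁ ^ (q - 1)) :
    {p : ℕ | p.Prime ∧ Odd p ∧ ¬ p ∣ x₁ * y₁ ∧ ellp x₁ y₁ p ∣ m ∧
      q ∣ ellp x₁ y₁ p}.Finite ∧
    {p : ℕ | p.Prime ∧ Odd p ∧ ¬ p ∣ x₁ * y₁ ∧ ellp x₁ y₁ p ∣ m ∧
      q ∣ ellp x₁ y₁ p}.ncard ≤ k := by
  have hd0 : 0 < d₁ := hd₁ ▸ Nat.gcd_pos_of_pos_left y hx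
  have hxe : x = d₁ * x₁ := by
    rw [hx₁, Nat.mul_div_cancel' (hd₁ ▸ Nat.gcd_dvd_left x y)]
  have hye : y = d₁ * y₁ := by
    rw [hy₁, Nat.mul_div_cancel' (hd₁ ▸ Nat.gcd_dvd_right x y)]
  have hcop : x₁.Coprime y₁ := by
    rw [hx₁, hy₁, hd₁]
    exact Nat.coprime_div_gcd_div_gcd (hd₁ ▸ hd0)
  have hlt : y₁ < x₁ := by
    rw [hxe, hye] at hxy
    exact Nat.lt_of_mul_lt_mul_left hxy
  obtain ⟨A, hA, hA'⟩ := quot_form d₁ x₁ y₁ m hd0 hlt hm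
  obtain ⟨B, hB, hB'⟩ := quot_form d₁ x₁ y₁ n hd0 hlt hn
  rw [← hxe, ← hye] at hA' hB'
  rw [hA', hB'] at heq
  have hXm : 0 < x₁ ^ m - y₁ ^ m := Nat.sub_pos_of_lt (Nat.pow_lt_pow_left hlt hm.ne')
  have hXn : 0 < x₁ ^ n - y₁ ^ n := Nat.sub_pos_of_lt (Nat.pow_lt_pow_left hlt hn.ne')
  have hA0 : A ≠ 0 := by rintro rfl; simp at hA; omega
  have hB0 : B ≠ 0 := by rintro rfl; simp at hB; omega
  have hqn : ¬ q ∣ n := fun h =>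
    hq.one_lt.ne' (Nat.dvd_one.1 (hgcd ▸ Nat.dvd_gcd hqm h))
  have hvB : B.factorization q < k := by
    by_contra hc
    push Not at hc
    rw [← hq.pow_dvd_iff_le_factorization hB0] at hc
    exact hqk (pow_dvd_sub_of x₁ y₁ q n k hlt.le hcop hq hn hk hqn (hB ▸ hc.mul_left _))
  have hdm : d₁ ^ (m - 1) ≠ 0 := (pow_pos hd0 _).ne'
  have hdn : d₁ ^ (n - 1) ≠ 0 := (pow_pos hd0 _).ne'
  have hN : z * (d₁ ^ (m - 1) * A) ≠ 0 := mul_ne_zero hz.ne' (mul_ne_zero hdm hA0)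
  have hfacts : ∀ p ∈ {p : ℕ | p.Prime ∧ Odd p ∧ ¬ p ∣ x₁ * y₁ ∧ ellp x₁ y₁ p ∣ m ∧
      q ∣ ellp x₁ y₁ p}, p.Prime ∧ p ∣ z * (d₁ ^ (m - 1) * A) ∧ q ∣ p - 1 := by
    rintro p ⟨hp, -, hpab, hlm, hql⟩
    obtain ⟨h1, h2, h3⟩ := ellp_dvd_facts x₁ y₁ p q m hlt.le hp hpab hq hlm hql
    refine ⟨hp, ?_, h1⟩
    rw [hA] at h2
    exact (((hp.dvd_mul.1 h2).resolve_left h3).mul_left _).mul_left _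
  have hfin : {p : ℕ | p.Prime ∧ Odd p ∧ ¬ p ∣ x₁ * y₁ ∧ ellp x₁ y₁ p ∣ m ∧
      q ∣ ellp x₁ y₁ p}.Finite :=
    (Nat.divisors (z * (d₁ ^ (m - 1) * A))).finite_toSet.subset fun p hp =>
      Finset.mem_coe.2 (Nat.mem_divisors.2 ⟨(hfacts p hp).2.1, hN⟩)
  refine ⟨hfin, ?_⟩
  rw [Set.ncard_eq_toFinset_card _ hfin]
  have hv := totient_val _ q hN hq hfin.toFinset
    (fun p hp => hfacts p (hfin.mem_toFinset.1 hp))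
  rw [heq, Nat.factorization_mul hz.ne' (mul_ne_zero hdm hA0), Nat.factorization_mul hdm hA0,
    Nat.factorization_mul hz.ne' (mul_ne_zero hdn hB0), Nat.factorization_mul hdn hB0,
    Nat.factorization_pow, Nat.factorization_pow] at hv
  simp only [Finsupp.add_apply, Finsupp.smul_apply, smul_eq_mul] at hv
  have hmono : (n - 1) * d₁.factorization q ≤ (m - 1) * d₁.factorization q :=
    Nat.mul_le_mul_right _ (by omega)
  omega
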